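/- Let L ⊆ A* be a factorial language that is balanced for length n and σ: A* → B* a non-erasing substitution (i.e., |σ(a)| ≥ 1 for all a ∈ A). Then F(σ(L)) is balanced for length n. -/

import Mathlib

open List

/-- Number of occurrences of `v` as a factor of `w`, i.e. the number of
decompositions `w = p ++ v ++ s`. -/
def occ {A : Type*} [DecidableEq A] (v w : List A) : ℕ :=
  (List.range (w.length + 1)).countP (fun i => decide (v <+: w.drop i))

/-- Apply a substitution (given by its values on letters) to a word. -/
def applyS {A B : Type*} (σ : A → List B) (w : List A) : List B :=
  (w.map σ).flatten

theorem prefix_append_iff_of_length_le {A : Type*} {v x : List A} (h : v.length ≤ x.length) (y : List A) :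
    v <+: x ++ y ↔ v <+: x :=
  ⟨fun hv => List.prefix_of_prefix_length_le hv (List.prefix_append x y) h,
    fun hv => hv.trans (List.prefix_append x y)⟩

section Occ

variable {A : Type*} [DecidableEq A]

theorem occ_append_eq (v x y : List A) :
    occ v (x ++ y) =
      (List.range x.length).countP (fun i => decide (v <+: (x ++ y).drop i)) + occ v y := by
  unfold occ
  rw [List.length_append, Nat.add_assoc, List.range_add, List.countP_append, List.countP_map]
  congr 1
  apply List.countP_congr
  intro i _
  simp [List.drop_append, List.drop_eq_nil_of_le (Nat.le_add_right x.length i)]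

theorem occ_cons (v : List A) (a : A) (w : List A) :
    occ v (a :: w) = (if v <+: a :: w then 1 else 0) + occ v w := by
  have h := occ_append_eq v [a] w
  simp only [List.singleton_append, List.length_singleton, List.range_one,
    List.countP_singleton, List.drop_zero, decide_eq_true_eq] at h
  exact h

theorem occ_le_length (v w : List A) : occ v w ≤ w.length + 1 := by
  unfold occ
  exact List.countP_le_length.trans (by simp)

theorem occ_nil_left (w : List A) : occ [] w = w.length + 1 := by
  simp [occ]

theorem occ_nil_right {v : List A} (hv : v ≠ []) : occ v [] = 0 := by
  simp [occ, hv]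

theorem occ_le_occ_append_left (v x y : List A) : occ v y ≤ occ v (x ++ y) := by
  rw [occ_append_eq]
  exact Nat.le_add_left _ _

theorem occ_append_left_le (v x y : List A) : occ v (x ++ y) ≤ x.length + occ v y := by
  rw [occ_append_eq]
  exact Nat.add_le_add_right (List.countP_le_length.trans (by simp)) _

theorem occ_le_occ_append_right {v : List A} (hv : v ≠ []) (x y : List A) :
    occ v x ≤ occ v (x ++ y) := by
  induction x with
  | nil => simp [occ_nil_right hv]
  | cons a x ih =>
    rw [List.cons_append, occ_cons, occ_cons]
    refine Nat.add_le_add ?_ ih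
    split_ifs with h1 h2
    · exact le_rfl
    · exact absurd (h1.trans (List.prefix_append (a :: x) y)) h2
    · exact Nat.zero_le _
    · exact le_rfl

theorem occ_append_right_le (v x y : List A) :
    occ v (x ++ y) ≤ occ v x + y.length + 1 + v.length := by
  suffices h : occ v (x ++ y) ≤ occ v x + y.length + 1 + min x.length v.length by omega
  induction x with
  | nil =>
    have := occ_le_length v y
    simp only [List.nil_append]
    omega
  | cons a x ih =>
    rw [List.cons_append, occ_cons, occ_cons, List.length_cons]
    by_cases hl : v.length ≤ (a :: x).length
    · have h := prefix_append_iff_of_length_le hl y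
      rw [List.cons_append] at h
      simp only [h]
      omega
    · rw [List.length_cons] at hl
      split_ifs <;> omega

theorem occ_infix_bounds {v : List A} (hv : v ≠ []) (p w s : List A) :
    occ v w ≤ occ v (p ++ w ++ s) ∧
      occ v (p ++ w ++ s) ≤ occ v w + p.length + s.length + 1 + v.length := by
  have h1 := occ_le_occ_append_left v p w
  have h2 := occ_append_left_le v p w
  have h3 := occ_le_occ_append_right hv (p ++ w) s
  have h4 := occ_append_right_le v (p ++ w) s
  omega

end Occ

section WindowSum

variable {A : Type*}

/-- Sum of `g` over the windows of length `n` of a word, the windows at the end being truncated. -/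
def windowSum (n : ℕ) (g : List A → ℕ) : List A → ℕ
  | [] => 0
  | a :: y => g ((a :: y).take n) + windowSum n g y

variable [DecidableEq A] [Fintype A]

theorem sum_occ_nil {n : ℕ} (hn : 1 ≤ n) (g : List A → ℕ) :
    ∑ u : List.Vector A n, occ u.toList [] * g u.toList = 0 := by
  refine Finset.sum_eq_zero fun u _ => ?_
  have hu : u.toList ≠ [] := by
    rw [← List.length_pos_iff, u.toList_length]
    exact hn
  rw [occ_nil_right hu, zero_mul]

theorem sum_occ_cons {n : ℕ} (g : List A → ℕ) (a : A) (y : List A) :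
    ∑ u : List.Vector A n, occ u.toList (a :: y) * g u.toList =
      (if n ≤ (a :: y).length then g ((a :: y).take n) else 0) +
        ∑ u : List.Vector A n, occ u.toList y * g u.toList := by
  simp only [occ_cons, add_mul, Finset.sum_add_distrib, ite_mul, one_mul, zero_mul]
  congr 1
  split_ifs with h
  · obtain ⟨x, hx⟩ : ∃ x : List.Vector A n, x.toList = (a :: y).take n :=
      ⟨⟨(a :: y).take n, by rw [List.length_take, min_eq_left h]⟩, rfl⟩
    rw [Finset.sum_eq_single x, if_pos (hx ▸ List.take_prefix _ _), hx]
    · intro u _ hu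
      refine if_neg fun hp => hu (List.Vector.toList_injective ?_)
      rw [List.prefix_iff_eq_take.1 hp, u.toList_length, hx]
    · simp
  · refine Finset.sum_eq_zero fun u _ => if_neg fun hp => h ?_
    have := hp.length_le
    rwa [u.toList_length] at this

theorem windowSum_bounds {n : ℕ} (hn : 1 ≤ n) {g : List A → ℕ} {G : ℕ} (hg : ∀ u, g u ≤ G)
    (y : List A) :
    ∑ u : List.Vector A n, occ u.toList y * g u.toList ≤ windowSum n g y ∧
      windowSum n g y ≤ (∑ u : List.Vector A n, occ u.toList y * g u.toList) + n * G := by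
  suffices h : ∑ u : List.Vector A n, occ u.toList y * g u.toList ≤ windowSum n g y ∧
      windowSum n g y ≤ (∑ u : List.Vector A n, occ u.toList y * g u.toList) + min y.length n * G from
    ⟨h.1, h.2.trans (Nat.add_le_add_left (Nat.mul_le_mul_right _ (min_le_right _ _)) _)⟩
  induction y with
  | nil => simp [windowSum, sum_occ_nil hn]
  | cons a y ih =>
    rw [sum_occ_cons, windowSum]
    have hG := hg ((a :: y).take n)
    obtain ⟨ih1, ih2⟩ := ih
    split_ifs with h
    · have : min y.length n * G ≤ min (a :: y).length n * G :=
        Nat.mul_le_mul_right _ (min_le_min_right _ (by simp))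
      omega
    · have : min (a :: y).length n * G = min y.length n * G + G := by
        rw [← Nat.succ_mul]
        congr 1
        rw [List.length_cons] at h ⊢
        omega
      omega

theorem windowSum_balanced {n C : ℕ} (hn : 1 ≤ n) {g : List A → ℕ} {G : ℕ} (hg : ∀ u, g u ≤ G)
    {y y' : List A}
    (hbal : ∀ v : List A, v.length = n → |(occ v y : ℤ) - (occ v y' : ℤ)| ≤ (C : ℤ)) :
    windowSum n g y ≤ windowSum n g y' + (Fintype.card (List.Vector A n) * (C * G) + n * G) := by
  have h1 := (windowSum_bounds hn hg y).2
  have h2 := (windowSum_bounds hn hg y').1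
  have h3 : ∑ u : List.Vector A n, occ u.toList y * g u.toList ≤
      (∑ u : List.Vector A n, occ u.toList y' * g u.toList) +
        Fintype.card (List.Vector A n) * (C * G) := by
    rw [← smul_eq_mul (Fintype.card _), ← Finset.card_univ, ← Finset.sum_const,
      ← Finset.sum_add_distrib]
    refine Finset.sum_le_sum fun u _ => ?_
    have hu : occ u.toList y ≤ occ u.toList y' + C := by
      have := (abs_le.1 (hbal u.toList u.toList_length)).2
      omega
    calc occ u.toList y * g u.toList ≤ (occ u.toList y' + C) * g u.toList := Nat.mul_le_mul_right _ hu
      _ = occ u.toList y' * g u.toList + C * g u.toList := add_mul _ _ _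
      _ ≤ _ := Nat.add_le_add_left (Nat.mul_le_mul_left _ (hg _)) _
  omega

end WindowSum

section Substitution

variable {A B : Type*} (σ : A → List B)

theorem applyS_cons (a : A) (y : List A) : applyS σ (a :: y) = σ a ++ applyS σ y := by
  simp [applyS]

theorem applyS_append (x y : List A) : applyS σ (x ++ y) = applyS σ x ++ applyS σ y := by
  simp [applyS]

variable {σ}

theorem length_le_length_applyS (hσ : ∀ a, 1 ≤ (σ a).length) (y : List A) :
    y.length ≤ (applyS σ y).length := by
  induction y with
  | nil => simp
  | cons a y ih =>
    have := hσ a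
    rw [applyS_cons, List.length_append, List.length_cons]
    omega

theorem exists_prefix_applyS {M : ℕ} (hM : ∀ a, (σ a).length ≤ M) {y : List A} {p s : List B}
    (h : p ++ s = applyS σ y) :
    ∃ z, z <+: y ∧ ∃ s' : List B, p ++ s' = applyS σ z ∧ s'.length ≤ M := by
  induction y generalizing p with
  | nil => exact ⟨[], List.prefix_rfl, s, h, by simp_all [applyS]⟩
  | cons a y ih =>
    rw [applyS_cons] at h
    rcases List.append_eq_append_iff.1 h with ⟨t, h1, -⟩ | ⟨t, h1, h2⟩
    · refine ⟨[a], by simp, t, by simp [applyS, h1], ?_⟩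
      have := hM a
      rw [h1, List.length_append] at this
      omega
    · obtain ⟨z, hz, s', hs', hl⟩ := ih h2.symm
      refine ⟨a :: z, by simpa using hz, s', ?_, hl⟩
      rw [applyS_cons, ← hs', h1, List.append_assoc]

theorem exists_infix_applyS {M : ℕ} (hM : ∀ a, (σ a).length ≤ M) {y : List A} {w : List B}
    (h : w <:+: applyS σ y) :
    ∃ z, z <:+: y ∧ ∃ p s : List B,
      p ++ w ++ s = applyS σ z ∧ p.length ≤ M ∧ s.length ≤ M := by
  obtain ⟨p, s, h⟩ := h
  induction y generalizing p with
  | nil => exact ⟨[], List.infix_rfl, p, s, h, by simp_all [applyS], by simp_all [applyS]⟩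
  | cons a y ih =>
    by_cases hp : p.length ≤ (σ a).length
    · obtain ⟨z, hz, s', hs', hl⟩ := exists_prefix_applyS hM h
      exact ⟨z, hz.isInfix, p, s', hs', hp.trans (hM a), hl⟩
    · rw [applyS_cons, List.append_assoc] at h
      rcases List.append_eq_append_iff.1 h with ⟨t, h1, -⟩ | ⟨t, -, h2⟩
      · rw [h1, List.length_append] at hp
        omega
      · obtain ⟨z, hz, h⟩ := ih t (by rw [h2, List.append_assoc])
        exact ⟨z, hz.trans (List.suffix_cons a y).isInfix, h⟩

variable (σ) in
/-- Length of the image of the first letter. -/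
def headLength : List A → ℕ
  | [] => 0
  | a :: _ => (σ a).length

variable (σ) in
/-- Number of occurrences of `v` in the image of a word that start in the image of its
first letter. -/
def headOcc [DecidableEq B] (v : List B) : List A → ℕ
  | [] => 0
  | a :: u => (List.range (σ a).length).countP
      (fun i => decide (v <+: (applyS σ (a :: u)).drop i))

theorem headLength_le {M : ℕ} (hM : ∀ a, (σ a).length ≤ M) (u : List A) :
    headLength σ u ≤ M := by
  cases u with
  | nil => exact Nat.zero_le _
  | cons a u => exact hM a

theorem headOcc_le [DecidableEq B] {M : ℕ} (hM : ∀ a, (σ a).length ≤ M) (v : List B)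
    (u : List A) : headOcc σ v u ≤ M := by
  cases u with
  | nil => exact Nat.zero_le _
  | cons a u => exact List.countP_le_length.trans (by simpa using hM a)

theorem length_applyS_eq_windowSum {n : ℕ} (hn : 1 ≤ n) (y : List A) :
    (applyS σ y).length = windowSum n (headLength σ) y := by
  induction y with
  | nil => simp [applyS, windowSum]
  | cons a y ih =>
    obtain ⟨m, rfl⟩ := Nat.exists_eq_add_of_le' hn
    rw [applyS_cons, List.length_append, ih, windowSum, List.take_succ_cons, headLength]

theorem headOcc_take [DecidableEq B] (hσ : ∀ a, 1 ≤ (σ a).length) {v : List B}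
    (hv : v ≠ []) (a : A) (y : List A) :
    headOcc σ v ((a :: y).take v.length) = headOcc σ v (a :: y) := by
  obtain ⟨m, hm⟩ := Nat.exists_eq_add_of_le' (List.length_pos_iff.2 hv)
  rw [hm, List.take_succ_cons]
  apply List.countP_congr
  intro i hi
  rw [List.mem_range] at hi
  rw [decide_eq_true_iff, decide_eq_true_iff]
  rcases le_total y.length m with hy | hy
  · rw [List.take_of_length_le hy]
  · have hsplit : applyS σ (a :: y) =
        applyS σ (a :: y.take m) ++ applyS σ (y.drop m) := by
      rw [← applyS_append, List.cons_append, List.take_append_drop]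
    have hlen : i + v.length ≤ (applyS σ (a :: y.take m)).length := by
      have h := length_le_length_applyS hσ (y.take m)
      rw [List.length_take, min_eq_left hy] at h
      rw [applyS_cons, List.length_append]
      omega
    rw [hsplit, List.drop_append_of_le_length (by omega),
      prefix_append_iff_of_length_le (by rw [List.length_drop]; omega)]

theorem occ_applyS_eq_windowSum [DecidableEq B] (hσ : ∀ a, 1 ≤ (σ a).length) {v : List B}
    (hv : v ≠ []) (y : List A) :
    occ v (applyS σ y) = windowSum v.length (headOcc σ v) y := by
  induction y with
  | nil => exact occ_nil_right hv
  | cons a y ih =>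
    rw [windowSum, headOcc_take hσ hv, headOcc, applyS_cons, occ_append_eq, ih]

end Substitution

/-- if the factorial language `L` is balanced for length `n` and `σ` is
a non-erasing substitution, then the set of factors of `σ(L)` is balanced for
length `n`. -/
theorem balanced_image_nonerasing {A B : Type*} [Fintype A] [DecidableEq A] [DecidableEq B]
    (L : Set (List A)) (n : ℕ) (σ : A → List B)
    (hfac : ∀ w ∈ L, ∀ v : List A, v <:+: w → v ∈ L)
    (hσ : ∀ a : A, 1 ≤ (σ a).length)
    (hbal : ∃ C : ℕ, ∀ v : List A, v.length = n → ∀ w ∈ L, ∀ w' ∈ L,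
      w.length = w'.length → |(occ v w : ℤ) - (occ v w' : ℤ)| ≤ (C : ℤ)) :
    ∃ C' : ℕ, ∀ v : List B, v.length = n →
      ∀ w ∈ {w : List B | ∃ y ∈ L, w <:+: applyS σ y},
        ∀ w' ∈ {w : List B | ∃ y ∈ L, w <:+: applyS σ y},
        w.length = w'.length → |(occ v w : ℤ) - (occ v w' : ℤ)| ≤ (C' : ℤ) := by
  obtain ⟨C, hC⟩ := hbal
  rcases Nat.eq_zero_or_pos n with rfl | hn
  · refine ⟨0, fun v hv w _ w' _ hww => ?_⟩
    rw [List.length_eq_zero_iff.1 hv, occ_nil_left, occ_nil_left, hww]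
    simp
  obtain ⟨M, hM⟩ : ∃ M, ∀ a, (σ a).length ≤ M :=
    ⟨Finset.univ.sup fun a => (σ a).length,
      fun a => Finset.le_sup (f := fun a => (σ a).length) (Finset.mem_univ a)⟩
  set K := Fintype.card (List.Vector A n) * (C * M) + n * M
  refine ⟨6 * M + 3 + 3 * n + 2 * K, fun v hv => ?_⟩
  have hv0 : v ≠ [] := List.length_pos_iff.1 (hv ▸ hn)
  have hlen : ∀ y ∈ L, ∀ y' ∈ L, y.length = y'.length →
      (applyS σ y).length ≤ (applyS σ y').length + K := by
    intro y hy y' hy' h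
    rw [length_applyS_eq_windowSum hn, length_applyS_eq_windowSum hn]
    exact windowSum_balanced hn (headLength_le hM) fun u hu => hC u hu y hy y' hy' h
  have hocc : ∀ y ∈ L, ∀ y' ∈ L, y.length = y'.length →
      occ v (applyS σ y) ≤ occ v (applyS σ y') + K := by
    intro y hy y' hy' h
    rw [occ_applyS_eq_windowSum hσ hv0, occ_applyS_eq_windowSum hσ hv0, hv]
    exact windowSum_balanced hn (headOcc_le hM v) fun u hu => hC u hu y hy y' hy' h
  rintro w ⟨y, hy, hw⟩ w' ⟨y', hy', hw'⟩ hww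
  obtain ⟨z, hz, p, s, hzw, hp, hs⟩ := exists_infix_applyS hM hw
  obtain ⟨z', hz', p', s', hzw', hp', hs'⟩ := exists_infix_applyS hM hw'
  replace hz := hfac y hy z hz
  replace hz' := hfac y' hy' z' hz'
  clear hw hw' hy hy' y y'
  wlog hle : z.length ≤ z'.length generalizing w w' z z' p s p' s'
  · rw [abs_sub_comm]
    exact this w' w hww.symm z' p' s' hzw' hp' hs' z p s hzw hp hs hz' hz (le_of_not_ge hle)
  have hx : z'.take z.length ∈ L := hfac z' hz' _ (List.take_prefix _ _).isInfix
  have hxl : z.length = (z'.take z.length).length := by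
    rw [List.length_take, min_eq_left hle]
  have hsplit : applyS σ z' =
      applyS σ (z'.take z.length) ++ applyS σ (z'.drop z.length) := by
    rw [← applyS_append, List.take_append_drop]
  have h1 := hlen z hz _ hx hxl
  have h2 := hocc z hz _ hx hxl
  have h3 := hocc _ hx z hz hxl.symm
  have h4 := occ_infix_bounds hv0 p w s
  have h5 := occ_infix_bounds hv0 p' w' s'
  have h6 := occ_le_occ_append_right hv0 (applyS σ (z'.take z.length))
    (applyS σ (z'.drop z.length))
  have h7 := occ_append_right_le v (applyS σ (z'.take z.length))
    (applyS σ (z'.drop z.length))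
  have h8 := congrArg List.length hzw
  have h9 := congrArg List.length hzw'
  have h10 := congrArg List.length hsplit
  rw [hzw] at h4
  rw [hzw'] at h5
  rw [← hsplit] at h6 h7
  simp only [List.length_append] at h8 h9 h10
  rw [abs_le]
  push_cast
  constructor <;> omega
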